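/- Let u ∈ l²_{h,0} be a grid function with Hermitian derivative u_x ∈ l²_{h,0}, and let s be the type-I cubic spline interpolating u. Then for every interior node x_j (1 ≤ j ≤ N−1), the jump of the third derivative of s at x_j equals h times the discrete biharmonic operator applied to u: s‴(x_j⁺) − s‴(x_j⁻) = h·(δ⁴ₓu)_j, where s‴(x_j⁺) and s‴(x_j⁻) denote the (constant) third derivatives of the cubic pieces of s on [x_j, x_{j+1}] and [x_{j−1}, x_j] respectively. -/

import Mathlib

open Set

/-- `IsHermDeriv N u v`: `v` is the Hermitian derivative of the grid function
`u ∈ l²_{h,0}` (with `h = 1/N`). -/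
def IsHermDeriv (N : ℕ) (u v : ℕ → ℝ) : Prop :=
  v 0 = 0 ∧ v N = 0 ∧
  ∀ j : ℕ, 1 ≤ j → j ≤ N - 1 →
    (1/6) * v (j-1) + (2/3) * v j + (1/6) * v (j+1)
      = (u (j+1) - u (j-1)) / (2 * ((1:ℝ)/N))

/-- The discrete biharmonic operator `δ⁴ₓ` (with `h = 1/N`). -/
noncomputable def dbh (N : ℕ) (u ux : ℕ → ℝ) (j : ℕ) : ℝ :=
  (12 / ((1:ℝ)/N)^2) *
    ((ux (j+1) - ux (j-1)) / (2 * ((1:ℝ)/N))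
      - (u (j+1) - 2 * u j + u (j-1)) / ((1:ℝ)/N)^2)

/-- `IsSpline N f s`: `s` is a type-I cubic spline for the data `f` on the uniform grid
`x_j = j/N`. -/
def IsSpline (N : ℕ) (f : ℕ → ℝ) (s : ℝ → ℝ) : Prop :=
  ContDiff ℝ 2 s ∧
  (∀ j : ℕ, j < N → ∃ p : Polynomial ℝ, p.degree ≤ 3 ∧
      ∀ x ∈ Set.Icc ((j : ℝ) / N) (((j : ℝ) + 1) / N), s x = p.eval x) ∧
  (∀ j : ℕ, j ≤ N → s ((j : ℝ) / N) = f j) ∧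
  s 0 = 0 ∧ deriv s 0 = 0 ∧ s 1 = 0 ∧ deriv s 1 = 0

open Polynomial in
/-- If a `C¹` function agrees with a polynomial on `[a, b]`, then so do the derivatives,
endpoints included. -/
theorem deriv_eqOn_eval_derivative_of_eqOn_Icc {f : ℝ → ℝ} (hf : ContDiff ℝ 1 f) {a b : ℝ}
    (hab : a < b) {p : ℝ[X]} (h : EqOn f (fun x => p.eval x) (Icc a b)) :
    EqOn (deriv f) (fun x => (derivative p).eval x) (Icc a b) := by
  have hIoo : EqOn (deriv f) (fun x => (derivative p).eval x) (Ioo a b) := by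
    intro x hx
    have he : f =ᶠ[nhds x] fun y => p.eval y :=
      Filter.eventuallyEq_of_mem (Icc_mem_nhds hx.1 hx.2) h
    simpa using he.deriv_eq
  have hcl := hIoo.closure (hf.continuous_deriv le_rfl) (derivative p).continuous
  rwa [closure_Ioo hab.ne] at hcl

open Polynomial in
/-- The derivatives of a cubic polynomial in terms of its Hermite data at `a` and `a + h`. -/
theorem cubic_derivatives_of_hermite_data {p : ℝ[X]} (hp : p.degree ≤ 3) (a h c : ℝ) :
    (derivative (derivative p)).eval a * h ^ 2
      = 6 * (p.eval (a + h) - p.eval a)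
        - h * (4 * (derivative p).eval a + 2 * (derivative p).eval (a + h)) ∧
    (derivative (derivative p)).eval (a + h) * h ^ 2
      = -6 * (p.eval (a + h) - p.eval a)
        + h * (2 * (derivative p).eval a + 4 * (derivative p).eval (a + h)) ∧
    (derivative (derivative (derivative p))).eval c * h ^ 3
      = 6 * h * ((derivative p).eval a + (derivative p).eval (a + h))
        - 12 * (p.eval (a + h) - p.eval a) := by
  have hnat : p.natDegree < 4 := Nat.lt_succ_of_le (natDegree_le_of_degree_le hp)
  rw [p.as_sum_range_C_mul_X_pow' hnat]
  simp only [Finset.sum_range_succ, Finset.sum_range_zero, derivative_add, derivative_mul,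
    derivative_C, derivative_X_pow, derivative_zero, derivative_natCast, eval_add, eval_mul,
    eval_C, eval_pow, eval_X, eval_zero, eval_natCast, map_natCast]
  norm_num
  refine ⟨?_, ?_, ?_⟩ <;> ring

/-- The homogeneous tridiagonal system `w (j-1) + 4 w j + w (j+1) = 0` with zero boundary values
has only the trivial solution. -/
theorem eq_zero_of_tridiagonal {N : ℕ} {w : ℕ → ℝ} (h0 : w 0 = 0) (hN : w N = 0)
    (h : ∀ j, j + 2 ≤ N → w j + 4 * w (j + 1) + w (j + 2) = 0) :
    ∀ j ≤ N, w j = 0 := by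
  obtain ⟨k, hk, hmax⟩ := (Finset.range (N + 1)).exists_max_image (fun j => |w j|) ⟨0, by simp⟩
  simp only [Finset.mem_range] at hk hmax
  have hwk : |w k| ≤ 0 := by
    rcases Nat.eq_zero_or_pos k with rfl | hpos
    · simp [h0]
    rcases (Nat.lt_succ_iff.mp hk).eq_or_lt with rfl | hlt
    · simp [hN]
    obtain ⟨i, rfl⟩ : ∃ i, k = i + 1 := ⟨k - 1, by omega⟩
    have e := h i (by omega)
    have h1 := abs_le.mp (hmax i (by omega))
    have h2 := abs_le.mp (hmax (i + 2) (by omega))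
    rcases abs_cases (w (i + 1)) with ⟨ha, _⟩ | ⟨ha, _⟩ <;> rw [ha] at h1 h2 ⊢ <;> linarith
  intro j hj
  exact abs_nonpos_iff.mp ((hmax j (by omega)).trans hwk)

/-- On each grid cell, the spline is given by a cubic polynomial with matching derivatives up to
order two at both endpoints. -/
theorem IsSpline.exists_piece {N : ℕ} {u : ℕ → ℝ} {s : ℝ → ℝ} (hs : IsSpline N u s) {j : ℕ}
    (hj : j < N) :
    ∃ p : Polynomial ℝ,
      (∀ x ∈ Icc ((j : ℝ) / N) (((j : ℝ) + 1) / N), s x = p.eval x) ∧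
      deriv (deriv s) ((j : ℝ) / N) * ((1 : ℝ) / N) ^ 2
        = 6 * (u (j + 1) - u j) - (1 : ℝ) / N *
          (4 * deriv s ((j : ℝ) / N) + 2 * deriv s (((j + 1 : ℕ) : ℝ) / N)) ∧
      deriv (deriv s) (((j + 1 : ℕ) : ℝ) / N) * ((1 : ℝ) / N) ^ 2
        = -6 * (u (j + 1) - u j) + (1 : ℝ) / N *
          (2 * deriv s ((j : ℝ) / N) + 4 * deriv s (((j + 1 : ℕ) : ℝ) / N)) ∧
      ∀ c, (Polynomial.derivative (Polynomial.derivative (Polynomial.derivative p))).eval c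
          * ((1 : ℝ) / N) ^ 3
        = 6 * ((1 : ℝ) / N) * (deriv s ((j : ℝ) / N) + deriv s (((j + 1 : ℕ) : ℝ) / N))
          - 12 * (u (j + 1) - u j) := by
  obtain ⟨hC, hpiece, hval, -⟩ := hs
  obtain ⟨p, hdeg, hp⟩ := hpiece j hj
  have hN : (0 : ℝ) < N := by exact_mod_cast (Nat.zero_le j).trans_lt hj
  have hlt : (j : ℝ) / N < ((j : ℝ) + 1) / N := by gcongr; linarith
  have hC' : ContDiff ℝ 1 (deriv s) := by
    have : ContDiff ℝ (1 + 1) s := by simpa [one_add_one_eq_two] using hC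
    exact (contDiff_succ_iff_deriv.mp this).2.2
  have d1 := deriv_eqOn_eval_derivative_of_eqOn_Icc (hC.of_le (by norm_num)) hlt hp
  have d2 := deriv_eqOn_eval_derivative_of_eqOn_Icc hC' hlt d1
  have hl := left_mem_Icc.mpr hlt.le
  have hr := right_mem_Icc.mpr hlt.le
  have v0 := hval j hj.le
  have v1 := hval (j + 1) hj
  have key := cubic_derivatives_of_hermite_data hdeg ((j : ℝ) / N) ((1 : ℝ) / N)
  push_cast at v1 ⊢
  rw [← add_div] at key
  rw [← v0, ← v1, hp _ hl, hp _ hr, d1 hl, d1 hr, d2 hl, d2 hr]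
  exact ⟨p, hp, (key 0).1, (key 0).2.1, fun c => (key c).2.2⟩

/-- The derivative of the interpolating type-I cubic spline at the nodes is the Hermitian
derivative of the data. -/
theorem IsSpline.deriv_eq_hermDeriv {N : ℕ} {u ux : ℕ → ℝ} {s : ℝ → ℝ} (hs : IsSpline N u s)
    (hN : 0 < N) (hux : IsHermDeriv N u ux) :
    ∀ j ≤ N, deriv s ((j : ℝ) / N) = ux j := by
  have hN' : (0 : ℝ) < N := by exact_mod_cast hN
  obtain ⟨ux0, uxN, hherm⟩ := hux
  have hw := eq_zero_of_tridiagonal (N := N) (w := fun j => deriv s ((j : ℝ) / N) - ux j)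
    (by simp [ux0, hs.2.2.2.2.1]) (by simp [uxN, hs.2.2.2.2.2.2, div_self hN'.ne']) ?_
  · exact fun j hj => sub_eq_zero.mp (hw j hj)
  intro j hj
  obtain ⟨-, -, -, hright, -⟩ := hs.exists_piece (show j < N by omega)
  obtain ⟨-, -, hleft, -⟩ := hs.exists_piece (show j + 1 < N by omega)
  have e := hherm (j + 1) (by omega) (by omega)
  have hh : (0 : ℝ) < (1 : ℝ) / N := by positivity
  simp only [Nat.add_sub_cancel, show j + 1 + 1 = j + 2 from rfl] at e hleft
  generalize (1 : ℝ) / N = h at *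
  rw [eq_div_iff (by positivity)] at e
  apply mul_left_cancel₀ hh.ne'
  linear_combination (hleft - hright) / 2 - 3 * e

/-- The jump of the third derivative of the interpolating cubic spline at an interior node
equals `h·(δ⁴ₓu)_j`: if `q` and `p` are the cubic pieces of `s` on `[x_{j-1}, x_j]` and
`[x_j, x_{j+1}]` respectively, then `p'''(x_j) - q'''(x_j) = h·(δ⁴ₓu)_j`. -/
theorem third_derivative_jump_eq_discrete_biharmonic
    (N : ℕ) (hN : 2 ≤ N) (u ux : ℕ → ℝ)
    (hu0 : u 0 = 0) (huN : u N = 0) (hux : IsHermDeriv N u ux)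
    (s : ℝ → ℝ) (hs : IsSpline N u s) :
    ∀ j : ℕ, 1 ≤ j → j ≤ N - 1 →
      ∀ p q : Polynomial ℝ,
        (∀ x ∈ Set.Icc (((j : ℝ) - 1) / N) ((j : ℝ) / N), s x = q.eval x) →
        (∀ x ∈ Set.Icc ((j : ℝ) / N) (((j : ℝ) + 1) / N), s x = p.eval x) →
        (Polynomial.derivative (Polynomial.derivative (Polynomial.derivative p))).eval
            ((j : ℝ) / N)
          - (Polynomial.derivative (Polynomial.derivative (Polynomial.derivative q))).eval
            ((j : ℝ) / N)
          = ((1:ℝ)/N) * dbh N u ux j := by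
  intro j hj1 hjN p q hq hp
  obtain ⟨i, rfl⟩ : ∃ i, j = i + 1 := ⟨j - 1, by omega⟩
  have hN' : (0 : ℝ) < N := by positivity
  obtain ⟨q', hq', -, -, hq3⟩ := hs.exists_piece (show i < N by omega)
  obtain ⟨p', hp', -, -, hp3⟩ := hs.exists_piece (show i + 1 < N by omega)
  have hinf : ∀ k : ℝ, (Icc (k / N) ((k + 1) / N)).Infinite := fun k =>
    Icc_infinite (by gcongr; linarith)
  obtain rfl : q = q' := by
    refine Polynomial.eq_of_infinite_eval_eq _ _ ((hinf i).mono fun x hx => ?_)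
    exact (hq x (by simpa using hx)).symm.trans (hq' x hx)
  obtain rfl : p = p' := by
    refine Polynomial.eq_of_infinite_eval_eq _ _ ((hinf (i + 1 : ℕ)).mono fun x hx => ?_)
    exact (hp x hx).symm.trans (hp' x hx)
  have hd := hs.deriv_eq_hermDeriv (by omega) hux
  have e1 := hq3 (((i + 1 : ℕ) : ℝ) / N)
  have e2 := hp3 (((i + 1 : ℕ) : ℝ) / N)
  rw [hd _ (by omega), hd _ (by omega)] at e1 e2
  have hh : (0 : ℝ) < (1 : ℝ) / N := by positivity
  simp only [dbh, Nat.add_sub_cancel]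
  generalize (1 : ℝ) / N = h at *
  apply mul_right_cancel₀ (pow_pos hh 3).ne'
  rw [sub_mul, e1, e2]
  field_simp
  ring
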